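/- Let d ≥ 2, 1 ≤ m ≤ d−1, λ ∈ (0,1/2), γ ∈ ℝ, 𝔇 = m log 2 / log(1/λ), and let Ω = (−1,1)^d. Write x = (x̄, x̂) ∈ ℝ^m × ℝ^{d−m}. For β > 0 and δ ∈ ℝ, if either d > 𝔇 + β, or d = 𝔇 + β and γ𝔇 + δ < −1, then the function x ↦ |x̂|^{−β} (log(e + |x̂|^{−1}))^δ · 1_{{dist(x̄, 𝔠^m_{λ,γ}) ≤ 4|x̂|}} belongs to L^1(Ω). -/

import Mathlib

open MeasureTheory Real Set Metric Filter Topology NNReal ENNReal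

noncomputable section

/-- `ℝ^n` with the Euclidean structure. -/
abbrev Euc (n : ℕ) := EuclideanSpace ℝ (Fin n)

/-- The open cube `(-1,1)^n`. -/
def Box (n : ℕ) : Set (Euc n) := {x | ∀ i, |x i| < 1}

/-- The last coordinate `x_d` of `x ∈ ℝ^{n+1}`. -/
def lastC {n : ℕ} (x : Euc (n + 1)) : ℝ := x (Fin.last n)

/-- The first `n` coordinates `x̄` of `x ∈ ℝ^{n+1}`. -/
def frontC {n : ℕ} (x : Euc (n + 1)) : Euc n := WithLp.toLp 2 fun i => x i.castSucc

/-- Assemble a point of `ℝ^{n+1}` from `x̄ ∈ ℝ^n` and a last coordinate. -/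
def snocC {n : ℕ} (xb : Euc n) (t : ℝ) : Euc (n + 1) :=
  WithLp.toLp 2 (Fin.snoc (α := fun _ => ℝ) xb.ofLp t)

/-- The first `m` coordinates of `x ∈ ℝ^{m+k}`. -/
def barPart {m k : ℕ} (x : Euc (m + k)) : Euc m := WithLp.toLp 2 fun i => x (Fin.castAdd k i)

/-- The last `k` coordinates of `x ∈ ℝ^{m+k}`. -/
def hatPart {m k : ℕ} (x : Euc (m + k)) : Euc k := WithLp.toLp 2 fun i => x (Fin.natAdd m i)

/-- Admissibility of a sequence of interval lengths for the generalized `(λ,γ)`-Cantor set: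
`l 0 = 1`, the lengths decrease fast enough (`l_{j-1} > 2 l_j`, removed gaps decreasing), and
`l j` is comparable to `λ^j j^γ`. -/
def IsCantorLengths (lam gam : ℝ) (l : ℕ → ℝ) : Prop :=
  l 0 = 1 ∧ (∀ j, 0 < l j) ∧ (∀ j, 2 * l (j + 1) < l j) ∧
    (∀ j, l (j + 1) - 2 * l (j + 2) < l j - 2 * l (j + 1)) ∧
    ∃ C : ℝ, 1 ≤ C ∧ ∀ j : ℕ, 1 ≤ j →
      C⁻¹ * lam ^ j * (j : ℝ) ^ gam ≤ l j ∧ l j ≤ C * lam ^ j * (j : ℝ) ^ gam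

/-- The point of the generalized Cantor set with address `ε` (left endpoints of the nested
intervals converge to this point). -/
def gCantorPoint (l : ℕ → ℝ) (ε : ℕ → Bool) : ℝ :=
  -(1 / 2 : ℝ) + ∑' j : ℕ, if ε j then l j - l (j + 1) else 0

/-- The generalized Cantor set determined by the lengths `l`. -/
def gCantorSet (l : ℕ → ℝ) : Set ℝ := Set.range (gCantorPoint l)

/-- The `m`-fold Cartesian power of the generalized Cantor set, inside `ℝ^m`. -/
def gCantorSetPi (l : ℕ → ℝ) (m : ℕ) : Set (Euc m) := {x | ∀ i, x i ∈ gCantorSet l}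

/-- The `j`-th binary digit of `t`. -/
def binDigit (t : ℝ) (j : ℕ) : Bool := ⌊t * 2 ^ (j + 1)⌋ % 2 = 1

/-- The Cantor measure attached to the lengths `l`: the image of the uniform distribution on
`[0,1)` under the map sending `t` to the Cantor point whose address is the binary digit
sequence of `t` (the digits being i.i.d. fair coins, this is the weak limit of the uniform
distributions on the pre-Cantor sets). -/
def gCantorMeasure (l : ℕ → ℝ) : Measure ℝ :=
  Measure.map (fun t => gCantorPoint l (binDigit t)) (volume.restrict (Set.Ico (0 : ℝ) 1))

/-- The `m`-fold product of the Cantor measure, as a measure on `ℝ^m`. -/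
def gCantorMeasurePi (l : ℕ → ℝ) (m : ℕ) : Measure (Euc m) :=
  Measure.map (⇑(MeasurableEquiv.toLp 2 (Fin m → ℝ)))
    (Measure.pi fun _ : Fin m => gCantorMeasure l)

/-- The fractal dimension `𝔇 = m log 2 / log(1/λ)`. -/
def frD (m : ℕ) (lam : ℝ) : ℝ := m * Real.log 2 / Real.log lam⁻¹

/-- `G` is the weak (distributional) differential of `u` on `Ω`:
integration by parts against smooth compactly supported test functions holds. -/
def HasWeakFDerivOn {n : ℕ} (Ω : Set (Euc n)) (u : Euc n → ℝ)
    (G : Euc n → Euc n →L[ℝ] ℝ) : Prop :=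
  ∀ φ : Euc n → ℝ, ContDiff ℝ (⊤ : ℕ∞) φ → HasCompactSupport φ → tsupport φ ⊆ Ω →
    ∫ x in Ω, u x • fderiv ℝ φ x = -∫ x in Ω, φ x • G x

/-- `u ∈ W^{1,1}(Ω)` with weak differential `G`. -/
def W11On {n : ℕ} (Ω : Set (Euc n)) (u : Euc n → ℝ) (G : Euc n → Euc n →L[ℝ] ℝ) : Prop :=
  IntegrableOn u Ω ∧ IntegrableOn G Ω ∧ HasWeakFDerivOn Ω u G

/-- `w ∈ W^{1,1}_0(Ω)` (with weak differential `G`): the extensions by zero form a Sobolev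
function on all of `ℝ^n`. -/
def ZeroBoundary {n : ℕ} (Ω : Set (Euc n)) (w : Euc n → ℝ)
    (G : Euc n → Euc n →L[ℝ] ℝ) : Prop :=
  Integrable (Set.indicator Ω w) ∧ Integrable (Set.indicator Ω G) ∧
    HasWeakFDerivOn Set.univ (Set.indicator Ω w) (Set.indicator Ω G)

/-- The energy `∫_Ω φ(x, g x) dx` for a scalar field `g` (typically `g = |∇w|`). -/
def energyOf {n : ℕ} (Ω : Set (Euc n)) (φ : Euc n → ℝ → ℝ) (g : Euc n → ℝ) : ℝ≥0∞ :=
  ∫⁻ x in Ω, ENNReal.ofReal (φ x (g x))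

/-- The Young (Legendre–Fenchel) conjugate `φ*(s) = sup_{t ≥ 0} (s t − φ(t))`. -/
def conjOrlicz (φ : ℝ → ℝ) (s : ℝ) : ℝ≥0∞ :=
  ⨆ t : ℝ≥0, ENNReal.ofReal (s * t - φ t)

/-- The conjugate energy `∫_Ω φ*(x, g x) dx`. -/
def energyConj {n : ℕ} (Ω : Set (Euc n)) (φ : Euc n → ℝ → ℝ) (g : Euc n → ℝ) : ℝ≥0∞ :=
  ∫⁻ x in Ω, conjOrlicz (φ x) (g x)

/-- `u` (with weak differential `G`, finite energy) is a local minimizer of the functional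
`w ↦ ∫_Ω φ(x,|∇w|) dx`: its energy does not exceed that of any Sobolev competitor that agrees
with `u` a.e. outside a compact subset of `Ω`. -/
def IsLocalMinimizer {n : ℕ} (Ω : Set (Euc n)) (φ : Euc n → ℝ → ℝ) (u : Euc n → ℝ)
    (G : Euc n → Euc n →L[ℝ] ℝ) : Prop :=
  W11On Ω u G ∧ energyOf Ω φ (fun x => ‖G x‖) < ⊤ ∧
    ∀ v Gv, W11On Ω v Gv →
      (∃ K : Set (Euc n), IsCompact K ∧ K ⊆ Ω ∧ ∀ᵐ x ∂(volume.restrict Ω), x ∉ K → v x = u x) →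
      energyOf Ω φ (fun x => ‖G x‖) ≤ energyOf Ω φ (fun x => ‖Gv x‖)

/-- `x` is a non-Lebesgue point of `u`: the averages of `|u − c|` on small balls around `x`
do not converge to `0` for any constant `c`. -/
def IsNonLebesguePoint {n : ℕ} (u : Euc n → ℝ) (x : Euc n) : Prop :=
  ¬ ∃ c : ℝ, Tendsto (fun r : ℝ => ⨍ y in Metric.ball x r, |u y - c| ∂volume)
      (𝓝[>] (0 : ℝ)) (𝓝 0)

/-- Membership in the Hölder class `C^α` on `s` (for `α ≥ 1` interpreted via
`C^{⌊α⌋, α − ⌊α⌋}`). -/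
def InHolderCls {n : ℕ} (α : ℝ) (s : Set (Euc n)) (a : Euc n → ℝ) : Prop :=
  ContDiffOn ℝ (⌊α⌋₊ : ℕ) a s ∧
    ∃ C : ℝ≥0, HolderOnWith C (Real.toNNReal (α - ⌊α⌋₊))
      (fun x => iteratedFDerivWithin ℝ ⌊α⌋₊ a s x) s

/-- The restricted Riesz potential `I₁^⋈(|f|)(x̄,0) = ∫_{C((x̄,0))} |f(y)| |x−y|^{1−d} dy`,
where `C(x)` is the double cone `{y : |ȳ − x̄| ≤ |y_d − x_d|/2}` (here `d = n+1`). -/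
def rieszBow {n : ℕ} (f : Euc (n + 1) → ℝ) (xb : Euc n) : ℝ≥0∞ :=
  ∫⁻ y : Euc (n + 1),
    ENNReal.ofReal ((if dist (frontC y) xb ≤ |lastC y| / 2 then (1 : ℝ) else 0) *
      |f y| * Real.sqrt (dist (frontC y) xb ^ 2 + lastC y ^ 2) ^ (-(n : ℝ)))

/-- The upper average `⟨f⟩⁺_{x̄,r} = ∫_{B_1} ω(y) f(x̄ + |r| ȳ, |r| y_d + |r|) dy`. -/
def avgPlus {n : ℕ} (ω : Euc (n + 1) → ℝ) (f : Euc (n + 1) → ℝ) (xb : Euc n) (r : ℝ) : ℝ :=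
  ∫ y in Metric.ball (0 : Euc (n + 1)) 1,
    ω y * f (snocC (xb + |r| • frontC y) (|r| * lastC y + |r|))

/-- The lower average `⟨f⟩⁻_{x̄,r} = ∫_{B_1} ω(y) f(x̄ + |r| ȳ, |r| y_d − |r|) dy`. -/
def avgMinus {n : ℕ} (ω : Euc (n + 1) → ℝ) (f : Euc (n + 1) → ℝ) (xb : Euc n) (r : ℝ) : ℝ :=
  ∫ y in Metric.ball (0 : Euc (n + 1)) 1,
    ω y * f (snocC (xb + |r| • frontC y) (|r| * lastC y - |r|))

open Classical in
/-- The function `u_d(x) = (1/2) sgn(x_d) θ(|x_d|/|x̄|)` (extended by its natural limit value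
`(1/2) sgn(x_d)` on the line `x̄ = 0`). -/
def uD {n : ℕ} (θ : ℝ → ℝ) (x : Euc (n + 1)) : ℝ :=
  if frontC x = 0 then (1 / 2) * Real.sign (lastC x)
  else (1 / 2) * Real.sign (lastC x) * θ (|lastC x| / ‖frontC x‖)

/-- Hypotheses on the profile function `θ`:
smooth on `(0,∞)`, `1_{(1/2,∞)} ≤ θ ≤ 1_{(1/4,∞)}` and `‖θ'‖_∞ ≤ 6`. -/
def IsProfile (θ : ℝ → ℝ) : Prop :=
  ContDiffOn ℝ (⊤ : ℕ∞) θ (Set.Ioi 0) ∧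
    (∀ t : ℝ, 0 < t → (if 1 / 2 < t then (1 : ℝ) else 0) ≤ θ t) ∧
    (∀ t : ℝ, 0 < t → θ t ≤ if 1 / 4 < t then 1 else 0) ∧
    (∀ t : ℝ, 0 < t → |deriv θ t| ≤ 6)

end


theorem aux_summable (m : ℕ) (lam gam s δ : ℝ) (h0 : 0 < lam) (h1 : lam < 1/2)
    (hcase : frD m lam < s ∨ (s = frD m lam ∧ gam * frD m lam + δ < -1)) :
    Summable (fun j : ℕ => ((2:ℝ)^m * lam^s)^(j+1) * (((j+1:ℕ):ℝ))^(gam*s+δ)) := by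
  have hlog : 0 < Real.log lam⁻¹ := Real.log_pos (by
    rw [one_lt_inv₀ h0]; linarith)
  have hq : (2:ℝ)^m * lam^s = Real.exp (m * Real.log 2 - s * Real.log lam⁻¹) := by
    rw [Real.rpow_def_of_pos h0, Real.log_inv, ← Real.rpow_natCast, Real.rpow_def_of_pos (by norm_num),
      ← Real.exp_add]
    congr 1; ring
  apply (_root_.summable_nat_add_iff (f := fun n : ℕ => ((2:ℝ)^m * lam^s)^n * ((n:ℝ))^(gam*s+δ)) 1).mpr
  rcases hcase with h | ⟨h, h'⟩
  · have hq1 : (2:ℝ)^m * lam^s < 1 := by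
      rw [hq, Real.exp_lt_one_iff]
      unfold frD at h
      rw [div_lt_iff₀ hlog] at h
      linarith
    have hq0 : 0 ≤ (2:ℝ)^m * lam^s := by positivity
    generalize (2:ℝ)^m * lam^s = q at *
    refine Summable.of_nonneg_of_le (fun n => by positivity) ?_
      ((summable_pow_mul_geometric_of_norm_lt_one ⌈|gam*s+δ|⌉₊ (r := q) (by
        rw [Real.norm_of_nonneg hq0]; exact hq1)).add
        (summable_of_ne_finset_zero (f := fun n : ℕ => if n = 0 then (1:ℝ) else 0) (s := {0}) (by
          intro b hb; simp at hb; simp [hb])))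
    intro n
    rcases Nat.eq_zero_or_pos n with rfl | hn
    · simp only [Nat.cast_zero, pow_zero, one_mul, if_true, mul_one]
      have : (0:ℝ) ≤ 0 ^ ⌈|gam*s+δ|⌉₊ := by positivity
      have := Real.zero_rpow_le_one (gam*s+δ)
      linarith
    · have hn1 : (1:ℝ) ≤ n := by exact_mod_cast hn
      rw [if_neg hn.ne', add_zero, mul_comm]
      gcongr
      rw [← Real.rpow_natCast]
      apply Real.rpow_le_rpow_of_exponent_le hn1
      exact (le_abs_self _).trans (Nat.le_ceil _)
  · have hq1 : (2:ℝ)^m * lam^s = 1 := by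
      rw [hq, Real.exp_eq_one_iff, h]; unfold frD; rw [div_mul_cancel₀ _ hlog.ne', sub_self]
    simp only [hq1, one_pow, one_mul]
    rw [h]
    exact Real.summable_nat_rpow.mpr h'

theorem aux_pow {l : ℕ → ℝ} (h0 : l 0 = 1) (h2 : ∀ j, 2 * l (j + 1) < l j) (j : ℕ) :
    l j ≤ (1/2:ℝ)^j := by
  induction j with
  | zero => simp [h0]
  | succ n ih => rw [pow_succ]; have := h2 n; linarith

def aux_F (l : ℕ → ℝ) (j : ℕ) : Set ℝ :=
  ⋃ a : Fin j → Bool, Metric.closedBall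
    (-(1 / 2 : ℝ) + ∑ i : Fin j, if a i then l i - l (i + 1) else 0) (5 * l j)

theorem aux_F_vol {l : ℕ → ℝ} (hp : ∀ j, 0 < l j) (j : ℕ) :
    volume (aux_F l j) ≤ ENNReal.ofReal (2 ^ j * (10 * l j)) := by
  refine (measure_iUnion_le _).trans ?_
  simp only [Real.volume_closedBall, tsum_fintype, Finset.sum_const, Finset.card_univ]
  rw [Fintype.card_fun, Fintype.card_bool, Fintype.card_fin, nsmul_eq_mul,
    ENNReal.ofReal_mul (p := 2 ^ j) (by positivity)]
  apply le_of_eq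
  congr 1
  · rw [ENNReal.ofReal_pow (by norm_num)]; simp
  · congr 1; ring

theorem aux_cantor {l : ℕ → ℝ} (h0 : l 0 = 1) (hp : ∀ j, 0 < l j)
    (h2 : ∀ j, 2 * l (j + 1) < l j) (j : ℕ) {t y : ℝ} (hy : y ∈ gCantorSet l)
    (hty : |t - y| ≤ 4 * l j) : t ∈ aux_F l j := by
  obtain ⟨ε, rfl⟩ := hy
  have hlim : Tendsto l atTop (𝓝 0) :=
    squeeze_zero (fun j => (hp j).le) (aux_pow h0 h2)
      (tendsto_pow_atTop_nhds_zero_of_lt_one (by norm_num) (by norm_num))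
  have hnn : ∀ i, 0 ≤ l i - l (i+1) := fun i => by have := h2 i; have := hp (i+1); linarith
  have htel : ∀ n, ∑ i ∈ Finset.range n, (l (i + j) - l (i + j + 1)) = l j - l (n + j) := by
    intro n
    induction n with
    | zero => simp
    | succ n ih => rw [Finset.sum_range_succ, ih]; rw [show n + 1 + j = n + j + 1 by ring]; ring
  have hsumj : HasSum (fun i => l (i + j) - l (i + j + 1)) (l j) := by
    rw [hasSum_iff_tendsto_nat_of_nonneg (fun i => hnn _)]
    simp only [htel]
    simpa using (((tendsto_add_atTop_iff_nat j).mpr hlim).const_sub (l j))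
  set g : ℕ → ℝ := fun i => if ε i then l i - l (i + 1) else 0 with hg
  have hg0 : ∀ i, 0 ≤ g i := fun i => by
    simp only [hg]; split_ifs; exacts [hnn i, le_rfl]
  have hgle : ∀ i, g i ≤ l i - l (i+1) := fun i => by
    simp only [hg]; split_ifs; exacts [le_rfl, hnn i]
  have hgj : Summable (fun i => g (i + j)) :=
    Summable.of_nonneg_of_le (fun i => hg0 _) (fun i => hgle _) hsumj.summable
  have hgs : Summable g := (_root_.summable_nat_add_iff j).mp hgj
  have htail0 : 0 ≤ ∑' i, g (i + j) := tsum_nonneg fun i => hg0 _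
  have htail1 : ∑' i, g (i + j) ≤ l j := by
    rw [← hsumj.tsum_eq]
    exact hgj.tsum_le_tsum (fun i => hgle _) hsumj.summable
  have hsplit := hgs.sum_add_tsum_nat_add j
  refine mem_iUnion.mpr ⟨fun i => ε i, ?_⟩
  have hfin : (∑ i : Fin j, if ε i then l i - l (i + 1) else 0) = ∑ i ∈ Finset.range j, g i :=
    Fin.sum_univ_eq_sum_range g j
  rw [mem_closedBall, Real.dist_eq, hfin]
  have hpt : gCantorPoint l ε = -(1/2) + ∑' i, g i := rfl
  rw [hpt, ← hsplit] at hty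
  rw [abs_le] at *
  constructor <;> linarith [hty.1, hty.2]

def aux_P (l : ℕ → ℝ) (m k j : ℕ) : Set (Euc (m + k)) :=
  {x | (∀ i, barPart x i ∈ aux_F l j) ∧ ∀ i, hatPart x i ∈ Icc (-l j) (l j)}

theorem aux_P_vol {l : ℕ → ℝ} (hp : ∀ j, 0 < l j) (m k j : ℕ) :
    volume (aux_P l m k j) ≤ ENNReal.ofReal ((2 ^ j * (10 * l j)) ^ m * (2 * l j) ^ k) := by
  have hlj := hp j
  set s : Fin (m + k) → Set ℝ :=
    Fin.addCases (fun _ => aux_F l j) (fun _ => Icc (-l j) (l j)) with hs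
  have heq : aux_P l m k j = (WithLp.ofLp : Euc (m+k) → (Fin (m + k) → ℝ)) ⁻¹' (Set.univ.pi s) := by
    ext x
    simp only [aux_P, Set.mem_ofPred_eq, mem_preimage, Set.mem_univ_pi]
    constructor
    · rintro ⟨h1, h2⟩ i
      refine Fin.addCases (fun i => ?_) (fun i => ?_) i
      · simpa [hs, barPart] using h1 i
      · simpa [hs, hatPart] using h2 i
    · intro h
      refine ⟨fun i => ?_, fun i => ?_⟩
      · simpa [hs, barPart] using h (Fin.castAdd k i)
      · simpa [hs, hatPart] using h (Fin.natAdd m i)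
  have hF : MeasurableSet (aux_F l j) :=
    MeasurableSet.iUnion fun _ => Metric.isClosed_closedBall.measurableSet
  have hms : MeasurableSet (Set.univ.pi s) := by
    refine MeasurableSet.univ_pi fun i => ?_
    refine Fin.addCases (fun i => ?_) (fun i => ?_) i
    · simpa [hs] using hF
    · simp [hs]
  rw [heq, (PiLp.volume_preserving_ofLp (Fin (m+k))).measure_preimage hms.nullMeasurableSet,
    volume_pi_pi, Fin.prod_univ_add]
  simp only [hs, Fin.addCases_left, Fin.addCases_right, Finset.prod_const, Finset.card_univ,
    Fintype.card_fin, Real.volume_Icc]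
  rw [ENNReal.ofReal_mul (by positivity), ENNReal.ofReal_pow (by positivity),
    ENNReal.ofReal_pow (by positivity)]
  gcongr
  · exact aux_F_vol hp j
  · linarith

theorem aux_log {l : ℕ → ℝ} (h0 : l 0 = 1) (hp : ∀ j, 0 < l j)
    (h2 : ∀ j, 2 * l (j + 1) < l j) {lam gam C : ℝ} (hlam0 : 0 < lam) (hlam1 : lam < 1/2)
    (hC : 1 ≤ C) (hl : ∀ j : ℕ, 1 ≤ j → C⁻¹ * lam ^ j * (j : ℝ) ^ gam ≤ l j) (δ : ℝ) :
    ∃ K : ℝ, 0 < K ∧ ∀ j : ℕ, ∀ r : ℝ, l (j+1) ≤ r → r < l j →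
      Real.log (Real.exp 1 + r⁻¹) ^ δ ≤ K * (((j+1 : ℕ) : ℝ)) ^ δ := by
  set A : ℝ := C * lam⁻¹ * 2 ^ |gam| with hA
  have hA0 : 0 < A := by positivity
  have hlow : ∀ j : ℕ, ∀ r : ℝ, 0 < r → r < l j →
      (1/4) * (((j+1 : ℕ) : ℝ)) ≤ Real.log (Real.exp 1 + r⁻¹) := by
    intro j r hr hrl
    have h1 : (2:ℝ)^j ≤ r⁻¹ := by
      rw [le_inv_comm₀ (by positivity) hr, ← inv_pow]
      have := aux_pow h0 h2 j
      rw [one_div] at this; linarith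
    have h3 : 1 ≤ Real.log (Real.exp 1 + r⁻¹) := by
      rw [Real.le_log_iff_exp_le (by positivity)]
      have : 0 < r⁻¹ := by positivity
      linarith
    have h4 : j * Real.log 2 ≤ Real.log (Real.exp 1 + r⁻¹) := by
      rw [← Real.log_pow]
      apply Real.log_le_log (by positivity)
      have := Real.exp_pos 1
      linarith
    have := Real.log_two_gt_d9
    push_cast
    nlinarith [(Nat.cast_nonneg j : (0:ℝ) ≤ j)]
  have hup : ∀ j : ℕ, ∀ r : ℝ, l (j+1) ≤ r →
      Real.log (Real.exp 1 + r⁻¹) ≤ Real.log (Real.exp 1 + A) * (((j+1 : ℕ) : ℝ)) := by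
    intro j r hr
    have hr0 : 0 < r := (hp _).trans_le hr
    have hn1 : (1:ℝ) ≤ ((j+1:ℕ):ℝ) := by push_cast; linarith [(Nat.cast_nonneg j : (0:ℝ) ≤ j)]
    have h1 : r⁻¹ ≤ A ^ (j+1) := by
      have e1 : r⁻¹ ≤ (C⁻¹ * lam ^ (j+1) * ((j+1:ℕ) : ℝ) ^ gam)⁻¹ :=
        inv_anti₀ (by positivity) ((hl (j+1) (by omega)).trans hr)
      refine e1.trans ?_
      rw [mul_inv, mul_inv, inv_inv, hA, mul_pow, mul_pow, inv_pow]
      gcongr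
      · exact le_self_pow₀ hC (by omega)
      · rw [← Real.rpow_neg (by positivity)]
        calc ((j+1:ℕ):ℝ) ^ (-gam) ≤ ((j+1:ℕ):ℝ) ^ |gam| :=
              Real.rpow_le_rpow_of_exponent_le hn1 (neg_le_abs gam)
          _ ≤ ((2:ℝ)^(j+1)) ^ |gam| := by
              apply Real.rpow_le_rpow (by positivity) _ (abs_nonneg _)
              exact_mod_cast (Nat.lt_two_pow_self (n := j+1)).le
          _ = _ := by
              rw [← Real.rpow_natCast, ← Real.rpow_natCast, ← Real.rpow_mul (by norm_num),
                ← Real.rpow_mul (by norm_num), mul_comm]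
    rw [mul_comm, ← Real.log_pow]
    apply Real.log_le_log (by positivity)
    have e2 : Real.exp 1 ≤ Real.exp 1 ^ (j+1) :=
      le_self_pow₀ (Real.one_le_exp (by norm_num)) (by omega)
    have e3 := pow_add_pow_le (Real.exp_pos 1).le hA0.le (n := j+1) (by omega)
    linarith
  have hB : 0 < Real.log (Real.exp 1 + A) := by
    apply Real.log_pos
    have := Real.one_le_exp (x := 1) (by norm_num)
    linarith
  rcases le_total 0 δ with hδ | hδ
  · refine ⟨Real.log (Real.exp 1 + A) ^ δ, by positivity, fun j r h1 h3 => ?_⟩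
    have hr0 : 0 < r := (hp _).trans_le h1
    rw [← Real.mul_rpow hB.le (by positivity)]
    apply Real.rpow_le_rpow _ (hup j r h1) hδ
    exact le_trans (by positivity) (hlow j r hr0 h3)
  · refine ⟨(1/4) ^ δ, by positivity, fun j r h1 h3 => ?_⟩
    have hr0 : 0 < r := (hp _).trans_le h1
    rw [← Real.mul_rpow (by norm_num) (by positivity)]
    exact Real.rpow_le_rpow_of_nonpos (by positivity) (hlow j r hr0 h3) hδ

theorem aux_ratio {l : ℕ → ℝ} (h0 : l 0 = 1) (hp : ∀ j, 0 < l j)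
    {lam gam C : ℝ} (hlam0 : 0 < lam)
    (hC : 1 ≤ C) (hl : ∀ j : ℕ, 1 ≤ j →
      C⁻¹ * lam ^ j * (j : ℝ) ^ gam ≤ l j ∧ l j ≤ C * lam ^ j * (j : ℝ) ^ gam) :
    ∃ R : ℝ, 0 < R ∧ ∀ j, l j ≤ R * l (j+1) := by
  refine ⟨C * C * lam⁻¹ * 2 ^ |gam| + (l 1)⁻¹, by have := hp 1; positivity, fun j => ?_⟩
  have hl1 := hp 1
  have hlj := hp (j+1)
  rcases Nat.eq_zero_or_pos j with rfl | hj
  · rw [h0, zero_add, add_mul, inv_mul_cancel₀ hl1.ne']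
    have : 0 ≤ C * C * lam⁻¹ * 2 ^ |gam| * l 1 := by positivity
    linarith
  have hj1 : (1:ℝ) ≤ j := by exact_mod_cast hj
  have e1 := (hl j hj).2
  have e2 := (hl (j+1) (by omega)).1
  have e3 : (j:ℝ) ^ gam ≤ 2 ^ |gam| * ((j+1:ℕ):ℝ) ^ gam := by
    rcases le_total 0 gam with h | h
    · calc (j:ℝ) ^ gam ≤ ((j+1:ℕ):ℝ) ^ gam := by
            apply Real.rpow_le_rpow (by positivity) _ h; push_cast; linarith
        _ ≤ _ := le_mul_of_one_le_left (by positivity)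
            (Real.one_le_rpow (by norm_num) (abs_nonneg _))
    · rw [abs_of_nonpos h, Real.rpow_neg (by norm_num), ← Real.inv_rpow (by norm_num),
        ← Real.mul_rpow (by norm_num) (by positivity)]
      apply Real.rpow_le_rpow_of_nonpos (by positivity) _ h
      push_cast; linarith
  calc l j ≤ C * lam ^ j * (j : ℝ) ^ gam := e1
    _ ≤ C * lam ^ j * (2 ^ |gam| * ((j+1:ℕ):ℝ) ^ gam) := by gcongr
    _ = (C * C * lam⁻¹ * 2 ^ |gam|) * (C⁻¹ * lam ^ (j+1) * ((j+1:ℕ):ℝ) ^ gam) := by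
        rw [pow_succ]; field_simp
    _ ≤ (C * C * lam⁻¹ * 2 ^ |gam|) * l (j+1) := by gcongr
    _ ≤ _ := by
        have : 0 ≤ (l 1)⁻¹ * l (j+1) := by positivity
        linarith

theorem aux_cover {l : ℕ → ℝ} (h0 : l 0 = 1) (hp : ∀ j, 0 < l j)
    (h2 : ∀ j, 2 * l (j + 1) < l j) {m k : ℕ} (j : ℕ) (x : Euc (m + k))
    (hx : ‖hatPart x‖ < l j)
    (hd : Metric.infDist (barPart x) (gCantorSetPi l m) ≤ 4 * ‖hatPart x‖) :
    x ∈ aux_P l m k j := by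
  have hne : (gCantorSetPi l m).Nonempty :=
    ⟨WithLp.toLp 2 fun _ => gCantorPoint l fun _ => true, fun i => ⟨_, rfl⟩⟩
  have : Metric.infDist (barPart x) (gCantorSetPi l m) < 4 * l j := by linarith
  obtain ⟨y, hy, hxy⟩ := (Metric.infDist_lt_iff hne).mp this
  constructor
  · intro i
    refine aux_cantor h0 hp h2 j (hy i) ?_
    rw [dist_eq_norm] at hxy
    have := PiLp.norm_apply_le (barPart x - y) i
    rw [Real.norm_eq_abs] at this
    exact this.trans hxy.le
  · intro i
    have := PiLp.norm_apply_le (hatPart x) i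
    rw [Real.norm_eq_abs] at this
    exact abs_le.mp (this.trans hx.le)

theorem aux_shell {l : ℕ → ℝ} (h0 : l 0 = 1) (hp : ∀ j, 0 < l j)
    (h2 : ∀ j, 2 * l (j + 1) < l j) {r : ℝ} (hr : 0 < r) (hr1 : r < 1) :
    ∃ j, l (j+1) ≤ r ∧ r < l j := by
  have hlim : Tendsto l atTop (𝓝 0) :=
    squeeze_zero (fun j => (hp j).le) (aux_pow h0 h2)
      (tendsto_pow_atTop_nhds_zero_of_lt_one (by norm_num) (by norm_num))
  have hex : ∃ n, l n ≤ r := ((hlim.eventually (gt_mem_nhds hr)).exists).imp fun _ h => le_of_lt h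
  classical
  have hs := Nat.find_spec hex
  have hn0 : Nat.find hex ≠ 0 := by
    intro h; rw [h, h0] at hs; linarith
  obtain ⟨j, hj⟩ := Nat.exists_eq_succ_of_ne_zero hn0
  refine ⟨j, by rw [hj] at hs; exact hs, ?_⟩
  exact not_le.mp (Nat.find_min hex (by omega))

theorem aux_logbd (δ r : ℝ) (hr : 1 ≤ r) :
    Real.log (Real.exp 1 + r⁻¹) ^ δ ≤ Real.log (Real.exp 1 + 1) ^ |δ| := by
  have hri : 0 < r⁻¹ := by positivity
  have h3 : 1 ≤ Real.log (Real.exp 1 + r⁻¹) := by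
    rw [Real.le_log_iff_exp_le (by positivity)]
    linarith
  calc _ ≤ Real.log (Real.exp 1 + r⁻¹) ^ |δ| :=
        Real.rpow_le_rpow_of_exponent_le h3 (le_abs_self _)
    _ ≤ _ := by
        apply Real.rpow_le_rpow (by linarith) _ (abs_nonneg _)
        apply Real.log_le_log (by positivity)
        have : r⁻¹ ≤ 1 := inv_le_one_of_one_le₀ hr
        linarith

theorem aux_box (n : ℕ) : volume (Box n) < ⊤ := by
  refine lt_of_le_of_lt (measure_mono (t := Metric.closedBall (0 : Euc n) (Real.sqrt n)) ?_)
    measure_closedBall_lt_top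
  intro x hx
  rw [mem_closedBall_zero_iff, EuclideanSpace.norm_eq]
  apply Real.sqrt_le_sqrt
  calc ∑ i, ‖x i‖^2 ≤ ∑ i : Fin n, (1:ℝ) := by
        apply Finset.sum_le_sum
        intro i _
        have := hx i
        rw [Real.norm_eq_abs]
        exact pow_le_one₀ (abs_nonneg _) this.le
    _ = n := by simp

theorem aux_meas (m k : ℕ) (l : ℕ → ℝ) (β δ : ℝ) :
    Measurable (fun x : Euc (m + k) =>
        ‖hatPart x‖ ^ (-β) * Real.log (Real.exp 1 + ‖hatPart x‖⁻¹) ^ δ *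
          (if Metric.infDist (barPart x) (gCantorSetPi l m) ≤ 4 * ‖hatPart x‖ then (1:ℝ) else 0)) := by
  have hb : Continuous (barPart : Euc (m+k) → Euc m) := by unfold barPart; fun_prop
  have hh : Continuous (hatPart : Euc (m+k) → Euc k) := by unfold hatPart; fun_prop
  have hn : Measurable (fun x : Euc (m+k) => ‖hatPart x‖) := hh.norm.measurable
  refine Measurable.mul (Measurable.mul (by fun_prop) (by fun_prop)) ?_
  refine Measurable.ite ?_ measurable_const measurable_const
  exact measurableSet_le ((Metric.continuous_infDist_pt _).comp hb).measurable (by fun_prop)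

theorem aux_term {l : ℕ → ℝ} (hp : ∀ j, 0 < l j)
    {lam gam C R K β δ : ℝ} (hlam0 : 0 < lam) (hC : 1 ≤ C) (hR : 0 < R) (hK : 0 < K)
    (hl : ∀ j : ℕ, 1 ≤ j → l j ≤ C * lam ^ j * (j : ℝ) ^ gam)
    (hRl : ∀ j, l j ≤ R * l (j+1)) (m k : ℕ) (hs : 0 ≤ ((m + k : ℕ) : ℝ) - β) :
    ∃ M : ℝ, ∀ j : ℕ,
      (l (j+1) ^ (-β) * (K * (((j+1 : ℕ) : ℝ)) ^ δ)) * ((2 ^ j * (10 * l j)) ^ m * (2 * l j) ^ k)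
      ≤ M * (((2:ℝ)^m * lam^(((m + k : ℕ) : ℝ) - β))^(j+1) *
          (((j+1:ℕ):ℝ))^(gam*(((m + k : ℕ) : ℝ) - β)+δ)) := by
  set s := ((m + k : ℕ) : ℝ) - β with hsdef
  refine ⟨K * (10 * R) ^ m * (2 * R) ^ k * C ^ s, fun j => ?_⟩
  have hlj := hp (j+1)
  have hlj0 := hp j
  have hn0 : (0:ℝ) < ((j+1:ℕ):ℝ) := by positivity
  set n : ℝ := ((j+1:ℕ):ℝ) with hn
  set L := l (j+1) with hL
  have e1 : (2 ^ j * (10 * l j)) ^ m ≤ (2 ^ (j+1) * (10 * (R * L))) ^ m := by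
    gcongr
    · norm_num
    · omega
    · exact hRl j
  have e2 : (2 * l j) ^ k ≤ (2 * (R * L)) ^ k := by
    gcongr; exact hRl j
  have e3 : L ^ s ≤ C ^ s * (lam ^ s) ^ (j+1) * n ^ (gam * s) := by
    calc L ^ s ≤ (C * lam ^ (j+1) * n ^ gam) ^ s :=
          Real.rpow_le_rpow hlj.le (hl (j+1) (by omega)) hs
      _ = _ := by
          rw [Real.mul_rpow (by positivity) (by positivity),
            Real.mul_rpow (by positivity) (by positivity), ← Real.rpow_mul hn0.le,
            ← Real.rpow_natCast, ← Real.rpow_natCast, ← Real.rpow_mul hlam0.le,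
            ← Real.rpow_mul hlam0.le, mul_comm s]
  have e4 : L ^ s = L ^ (-β) * L ^ m * L ^ k := by
    rw [← Real.rpow_natCast, ← Real.rpow_natCast, ← Real.rpow_add hlj, ← Real.rpow_add hlj, hsdef]
    congr 1; push_cast; ring
  calc _ ≤ (L ^ (-β) * (K * n ^ δ)) * ((2 ^ (j+1) * (10 * (R * L))) ^ m * (2 * (R * L)) ^ k) := by
        gcongr
    _ = (K * (10 * R) ^ m * (2 * R) ^ k * ((2:ℝ) ^ m) ^ (j+1) * n ^ δ) * L ^ s := by
        rw [e4, ← pow_mul, mul_comm m, pow_mul]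
        simp only [mul_pow]; ring
    _ ≤ (K * (10 * R) ^ m * (2 * R) ^ k * ((2:ℝ) ^ m) ^ (j+1) * n ^ δ) *
          (C ^ s * (lam ^ s) ^ (j+1) * n ^ (gam * s)) := by gcongr
    _ = _ := by
        rw [Real.rpow_add hn0, mul_pow]; ring

theorem cantor_kernel_integrable
    {d m k : ℕ} (hd : d = m + k) (hd2 : 2 ≤ d) (hm : 1 ≤ m) (hk : 1 ≤ k)
    {lam gam : ℝ} (hlam0 : 0 < lam) (hlam1 : lam < 1 / 2)
    (l : ℕ → ℝ) (hl : IsCantorLengths lam gam l)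
    (β δ : ℝ) (hβ : 0 < β)
    (hcase : frD m lam + β < (d : ℝ) ∨ ((d : ℝ) = frD m lam + β ∧ gam * frD m lam + δ < -1)) :
    IntegrableOn
      (fun x : Euc (m + k) =>
        ‖hatPart x‖ ^ (-β) * Real.log (Real.exp 1 + ‖hatPart x‖⁻¹) ^ δ *
          (if Metric.infDist (barPart x) (gCantorSetPi l m) ≤ 4 * ‖hatPart x‖ then 1 else 0))
      (Box (m + k)) volume := by
  obtain ⟨h0, hp, h2, -, C, hC, hlC⟩ := hl
  subst hd
  have hfr : 0 ≤ frD m lam := by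
    unfold frD
    have : 0 < Real.log lam⁻¹ := Real.log_pos (by rw [one_lt_inv₀ hlam0]; linarith)
    have := Real.log_pos (x := 2) (by norm_num)
    positivity
  have hs : 0 ≤ ((m + k : ℕ) : ℝ) - β := by rcases hcase with h | ⟨h, _⟩ <;> linarith
  have hsum := aux_summable m lam gam (((m + k : ℕ) : ℝ) - β) δ hlam0 hlam1 (by
    rcases hcase with h | ⟨h, h'⟩
    · left; linarith
    · right; exact ⟨by linarith, h'⟩)
  obtain ⟨K, hK, hKl⟩ := aux_log h0 hp h2 hlam0 hlam1 hC (fun j hj => (hlC j hj).1) δ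
  obtain ⟨R, hR, hRl⟩ := aux_ratio h0 hp hlam0 hC hlC
  obtain ⟨M, hM⟩ := aux_term (β := β) (δ := δ) hp hlam0 hC hR hK (fun j hj => (hlC j hj).2) hRl m k hs
  set c : ℕ → ℝ := fun j => l (j+1) ^ (-β) * (K * (((j+1 : ℕ) : ℝ)) ^ δ) with hc
  have hc0 : ∀ j, 0 ≤ c j := fun j => by have := hp (j+1); positivity
  have hsum2 : Summable fun j => c j * ((2 ^ j * (10 * l j)) ^ m * (2 * l j) ^ k) :=
    Summable.of_nonneg_of_le (fun j => by have := hc0 j; have := hp j; positivity) hM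
      (hsum.mul_left M)
  set B : ℝ := Real.log (Real.exp 1 + 1) ^ |δ| with hB
  refine ⟨(aux_meas m k l β δ).aestronglyMeasurable, ?_⟩
  rw [hasFiniteIntegral_iff_enorm]
  have hPm : ∀ j, MeasurableSet (aux_P l m k j) := by
    intro j
    have hF : MeasurableSet (aux_F l j) :=
      MeasurableSet.iUnion fun _ => Metric.isClosed_closedBall.measurableSet
    have hb : Continuous (barPart : Euc (m+k) → Euc m) := by unfold barPart; fun_prop
    have hh : Continuous (hatPart : Euc (m+k) → Euc k) := by unfold hatPart; fun_prop
    have e1 : ∀ i, Measurable fun x : Euc (m+k) => barPart x i := fun i =>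
      Continuous.measurable (by fun_prop)
    have e2 : ∀ i, Measurable fun x : Euc (m+k) => hatPart x i := fun i =>
      Continuous.measurable (by fun_prop)
    have : aux_P l m k j = (⋂ i, (fun x : Euc (m+k) => barPart x i) ⁻¹' aux_F l j) ∩
        ⋂ i, (fun x : Euc (m+k) => hatPart x i) ⁻¹' Icc (-l j) (l j) := by
      ext x; simp [aux_P]
    rw [this]
    exact (MeasurableSet.iInter fun i => e1 i hF).inter
      (MeasurableSet.iInter fun i => e2 i measurableSet_Icc)
  calc _ ≤ ∫⁻ x in Box (m+k), (ENNReal.ofReal B +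
        ∑' j, (aux_P l m k j).indicator (fun _ => ENNReal.ofReal (c j)) x) := by
        apply lintegral_mono
        intro x
        simp only
        have hr0 := norm_nonneg (hatPart x)
        split_ifs with hx
        swap
        · simp
        rw [mul_one]
        set r := ‖hatPart x‖ with hr
        rcases hr0.eq_or_lt with h | h
        · rw [← h, Real.zero_rpow (by linarith)]; simp
        have hL : 0 ≤ Real.log (Real.exp 1 + r⁻¹) := by
          apply Real.log_nonneg
          have := Real.one_le_exp (x := 1) (by norm_num)
          have : 0 < r⁻¹ := by positivity
          linarith
        rw [Real.enorm_of_nonneg (by positivity)]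
        rcases le_or_gt 1 r with h1 | h1
        · refine le_trans (ENNReal.ofReal_le_ofReal ?_) le_self_add
          calc _ ≤ 1 * B := by
                gcongr
                · exact Real.rpow_le_one_of_one_le_of_nonpos h1 (by linarith)
                · exact aux_logbd δ r h1
            _ = B := one_mul _
        · obtain ⟨j, hj1, hj2⟩ := aux_shell h0 hp h2 h h1
          refine le_trans ?_ le_add_self
          refine le_trans ?_ (ENNReal.le_tsum j)
          rw [indicator_of_mem (aux_cover h0 hp h2 j x hj2 hx)]
          apply ENNReal.ofReal_le_ofReal
          simp only [hc]
          have := hp (j+1)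
          gcongr ?_ * ?_
          · exact Real.rpow_le_rpow_of_nonpos this hj1 (by linarith)
          · exact hKl j r hj1 hj2
    _ = ENNReal.ofReal B * volume (Box (m+k)) +
        ∑' j, ∫⁻ x in Box (m+k), (aux_P l m k j).indicator (fun _ => ENNReal.ofReal (c j)) x := by
        rw [lintegral_add_left measurable_const, lintegral_tsum (fun j =>
          (measurable_const.indicator (hPm j)).aemeasurable)]
        simp
    _ ≤ ENNReal.ofReal B * volume (Box (m+k)) +
        ∑' j, ENNReal.ofReal (c j * ((2 ^ j * (10 * l j)) ^ m * (2 * l j) ^ k)) := by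
        gcongr with j
        refine (setLIntegral_le_lintegral _ _).trans ?_
        rw [lintegral_indicator (hPm j), setLIntegral_const, ENNReal.ofReal_mul (hc0 j)]
        gcongr
        exact aux_P_vol hp m k j
    _ < ⊤ := by
        refine ENNReal.add_lt_top.mpr ⟨ENNReal.mul_lt_top ENNReal.ofReal_lt_top (aux_box _), ?_⟩
        exact hsum2.tsum_ofReal_lt_top
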